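/- arXiv:2509.07854 — 2 statements merged into one kernel-verified Lean document; each statement's English description precedes it below -/
import Mathlib

section
/- Let G be a finite simple graph with at least two vertices such that Z_t(G) exists, and let v be a vertex of G whose deletion leaves no isolated vertices in G − v. Then Z_t(G − v) exists and Z_t(G) − Z_t(G − v) ≤ 2. -/
open SimpleGraph

/-- One simultaneous application of the zero forcing color change rule:
a blue vertex `b` forces its unique white neighbor to become blue. -/
def zfStep {V : Type*} (G : SimpleGraph V) (B : Set V) : Set V :=
  B ∪ {w | ∃ b ∈ B, G.Adj b w ∧ ∀ w', G.Adj b w' → w' ∉ B → w' = w}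

/-- `B` is a zero forcing set if iterating the color change rule eventually
colors every vertex blue. -/
def IsZeroForcingSet {V : Type*} (G : SimpleGraph V) (B : Set V) : Prop :=
  ∃ n : ℕ, (zfStep G)^[n] B = Set.univ

/-- The zero forcing number `Z(G)`. -/
noncomputable def zeroForcingNumber {V : Type*} (G : SimpleGraph V) : ℕ :=
  sInf {m | ∃ B : Set V, IsZeroForcingSet G B ∧ B.ncard = m}

/-- `B` is a `k`-fault tolerant zero forcing set: every subset of `B` of
cardinality `|B| - k` is a zero forcing set. -/
def IsFaultTolerant {V : Type*} (G : SimpleGraph V) (k : ℕ) (B : Set V) : Prop :=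
  ∀ F ⊆ B, F.ncard = B.ncard - k → IsZeroForcingSet G F

/-- The `k`-fault tolerant zero forcing number `Z_t^k(G)`. -/
noncomputable def ftZeroForcingNumber {V : Type*} (G : SimpleGraph V) (k : ℕ) : ℕ :=
  sInf {m | ∃ B : Set V, IsFaultTolerant G k B ∧ B.ncard = m}

/-- A set of vertices is closed under the color change rule when no vertex in it forces a
vertex outside it. -/
def IsForcingClosed {V : Type*} (G : SimpleGraph V) (C : Set V) : Prop :=
  ∀ b ∈ C, ∀ w, G.Adj b w → (∀ w', G.Adj b w' → w' ∉ C → w' = w) → w ∈ C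

theorem zfStep_subset_of_isForcingClosed {V : Type*} {G : SimpleGraph V} {B C : Set V}
    (hC : IsForcingClosed G C) (h : B ⊆ C) : zfStep G B ⊆ C := by
  rintro w (hw | ⟨b, hb, hbw, hu⟩)
  · exact h hw
  · exact hC b (h hb) w hbw fun w' hw' hn => hu w' hw' fun hB => hn (h hB)

theorem IsForcingClosed.sInter {V : Type*} {G : SimpleGraph V} {S : Set (Set V)}
    (hS : ∀ C ∈ S, IsForcingClosed G C) : IsForcingClosed G (⋂₀ S) := by
  intro b hb w hbw hu C hC
  exact hS C hC b (hb C hC) w hbw fun w' hw' hn => hu w' hw' fun h => hn (h C hC)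

theorem isZeroForcingSet_iff_forall_isForcingClosed {V : Type*} [Finite V] {G : SimpleGraph V}
    {B : Set V} :
    IsZeroForcingSet G B ↔ ∀ C, B ⊆ C → IsForcingClosed G C → C = Set.univ := by
  constructor
  · rintro ⟨n, hn⟩ C hBC hC
    have key : ∀ k, (zfStep G)^[k] B ⊆ C := by
      intro k
      induction k with
      | zero => exact hBC
      | succ k ih =>
        rw [Function.iterate_succ_apply']
        exact zfStep_subset_of_isForcingClosed hC ih
    exact Set.eq_univ_of_univ_subset (hn ▸ key n)
  · intro h
    have mono : Monotone fun k => (zfStep G)^[k] B := by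
      refine monotone_nat_of_le_succ fun k => ?_
      simp only [Function.iterate_succ_apply']
      exact Set.subset_union_left
    obtain ⟨n, hn⟩ := WellFoundedGT.monotone_chain_condition ⟨_, mono⟩
    refine ⟨n, h _ (mono (Nat.zero_le n)) fun b hb w hbw hu => ?_⟩
    have hs : (zfStep G)^[n] B = (zfStep G)^[n + 1] B := hn (n + 1) (Nat.le_succ n)
    rw [hs, Function.iterate_succ_apply']
    exact Or.inr ⟨b, hb, hbw, hu⟩

theorem IsZeroForcingSet.mono {V : Type*} [Finite V] {G : SimpleGraph V} {A B : Set V}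
    (hA : IsZeroForcingSet G A) (h : A ⊆ B) : IsZeroForcingSet G B := by
  rw [isZeroForcingSet_iff_forall_isForcingClosed] at hA ⊢
  exact fun C hBC => hA C (h.trans hBC)

theorem not_isZeroForcingSet_empty {V : Type*} [Finite V] [Nonempty V] (G : SimpleGraph V) :
    ¬ IsZeroForcingSet G ∅ := fun h =>
  Set.empty_ne_univ (isZeroForcingSet_iff_forall_isForcingClosed.1 h ∅ subset_rfl
    fun _ hb => hb.elim)

theorem IsFaultTolerant.diff_singleton {V : Type*} {G : SimpleGraph V} {B : Set V}
    (hB : IsFaultTolerant G 1 B) {y : V} (hy : y ∈ B) : IsZeroForcingSet G (B \ {y}) :=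
  hB _ Set.sdiff_subset (Set.ncard_sdiff_singleton_of_mem hy)

theorem IsFaultTolerant.nonempty {V : Type*} [Finite V] [Nonempty V] {G : SimpleGraph V}
    {B : Set V} (hB : IsFaultTolerant G 1 B) : B.Nonempty := by
  rw [Set.nonempty_iff_ne_empty]
  rintro rfl
  exact not_isZeroForcingSet_empty G (hB ∅ subset_rfl (by simp))

theorem IsFaultTolerant.isZeroForcingSet {V : Type*} [Finite V] [Nonempty V] {G : SimpleGraph V}
    {B : Set V} (hB : IsFaultTolerant G 1 B) : IsZeroForcingSet G B := by
  obtain ⟨y, hy⟩ := hB.nonempty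
  exact (hB.diff_singleton hy).mono Set.sdiff_subset

theorem isFaultTolerant_one_of_diff_singleton {V : Type*} [Finite V] {G : SimpleGraph V}
    {B : Set V} (hne : B.Nonempty) (h : ∀ y ∈ B, IsZeroForcingSet G (B \ {y})) :
    IsFaultTolerant G 1 B := by
  intro F hF hcard
  have hpos := (Set.ncard_pos B.toFinite).2 hne
  obtain ⟨y, hy, hyF⟩ := Set.exists_mem_notMem_of_ncard_lt_ncard (s := F) (t := B) (by omega)
  exact Set.eq_of_subset_of_ncard_le (Set.subset_sdiff_singleton hF hyF)
    (by rw [Set.ncard_sdiff_singleton_of_mem hy, hcard]) ▸ h y hy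

theorem isFaultTolerant_one_univ {V : Type*} [Finite V] [Nonempty V] {G : SimpleGraph V}
    (h : ∀ w, ∃ x, G.Adj w x) : IsFaultTolerant G 1 Set.univ := by
  refine isFaultTolerant_one_of_diff_singleton Set.univ_nonempty fun y _ => ?_
  rw [isZeroForcingSet_iff_forall_isForcingClosed]
  intro C hC hcl
  have hmem : ∀ z, z ≠ y → z ∈ C := fun z hz => hC ⟨Set.mem_univ z, hz⟩
  obtain ⟨x, hx⟩ := h y
  have hy : y ∈ C := hcl x (hmem x hx.ne') y hx.symm fun w' _ hn =>
    by_contra fun hne => hn (hmem w' hne)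
  refine Set.eq_univ_of_forall fun z => ?_
  by_cases hz : z = y
  · exact hz ▸ hy
  · exact hmem z hz

theorem IsFaultTolerant.exists_adj {V : Type*} [Finite V] {G : SimpleGraph V} {B : Set V}
    (hB : IsFaultTolerant G 1 B) (v : V) : ∃ u, G.Adj v u := by
  by_contra! hv
  obtain ⟨F, hF, hcard⟩ :=
    Set.exists_subset_card_eq (Set.pred_ncard_le_ncard_sdiff_singleton B v)
  have hzf := hB F (hF.trans Set.sdiff_subset) hcard
  have huniv := isZeroForcingSet_iff_forall_isForcingClosed.1 hzf {v}ᶜ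
    (fun x hx => (hF hx).2) fun b _ w hbw _ hw => by
      rw [Set.mem_singleton_iff.1 hw] at hbw
      exact hv b hbw.symm
  exact (huniv ▸ Set.mem_univ v : v ∈ ({v}ᶜ : Set V)) rfl

theorem IsZeroForcingSet.eq_univ_of_mem_deleted {V : Type*} [Finite V] {G : SimpleGraph V} {v : V}
    {S : Set ↥{x : V | x ≠ v}} (hS : IsZeroForcingSet (G.induce {x : V | x ≠ v}) S)
    {C : Set V} (hC : IsForcingClosed G C) (hv : v ∈ C) (hSC : Subtype.val '' S ⊆ C) :
    C = Set.univ := by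
  have h := isZeroForcingSet_iff_forall_isForcingClosed.1 hS (Subtype.val ⁻¹' C)
    (Set.image_subset_iff.1 hSC) fun b hb w hbw hu => hC b hb w hbw fun w' hw' hn =>
      congrArg Subtype.val (hu ⟨w', fun h => hn (h ▸ hv)⟩ hw' hn)
  refine Set.eq_univ_of_forall fun x => ?_
  by_cases hx : x = v
  · exact hx ▸ hv
  · exact (h ▸ Set.mem_univ _ : (⟨x, hx⟩ : ↥{x : V | x ≠ v}) ∈ Subtype.val ⁻¹' C)

theorem IsZeroForcingSet.insert_deleted {V : Type*} [Finite V] {G : SimpleGraph V} {v : V}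
    {S : Set ↥{x : V | x ≠ v}} (hS : IsZeroForcingSet (G.induce {x : V | x ≠ v}) S) :
    IsZeroForcingSet G (insert v (Subtype.val '' S)) := by
  rw [isZeroForcingSet_iff_forall_isForcingClosed]
  intro C hSC hC
  exact hS.eq_univ_of_mem_deleted hC (hSC (Set.mem_insert _ _))
    ((Set.subset_insert _ _).trans hSC)

/-- If forcing in `G` from a zero forcing set of `G - v` gets stuck, then some blue vertex has
exactly two white neighbors, one of which is `v`; the other one is the vertex to add. -/
theorem IsZeroForcingSet.exists_insert_of_deleted {V : Type*} [Finite V] {G : SimpleGraph V}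
    {v u : V} (hvu : G.Adj v u) {S : Set ↥{x : V | x ≠ v}}
    (hS : IsZeroForcingSet (G.induce {x : V | x ≠ v}) S) :
    ∃ x, x ≠ v ∧ IsZeroForcingSet G (insert x (Subtype.val '' S)) := by
  set C : Set V := ⋂₀ {C | Subtype.val '' S ⊆ C ∧ IsForcingClosed G C}
  have hC : IsForcingClosed G C := IsForcingClosed.sInter fun _ h => h.2
  have hSC : Subtype.val '' S ⊆ C := Set.subset_sInter fun _ h => h.1
  by_cases hv : v ∈ C
  · refine ⟨u, hvu.ne', isZeroForcingSet_iff_forall_isForcingClosed.2 fun D hSD hD => ?_⟩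
    have hSD' := (Set.subset_insert _ _).trans hSD
    have hCD : C ⊆ D := Set.sInter_subset_of_mem ⟨hSD', hD⟩
    exact hS.eq_univ_of_mem_deleted hD (hCD hv) hSD'
  have hne : (Subtype.val ⁻¹' C : Set ↥{x : V | x ≠ v}) ≠ Set.univ := by
    intro huniv
    have hmem : ∀ z, z ≠ v → z ∈ C := fun z hz =>
      (huniv ▸ Set.mem_univ _ : (⟨z, hz⟩ : ↥{x : V | x ≠ v}) ∈ Subtype.val ⁻¹' C)
    exact hv (hC u (hmem u hvu.ne') v hvu.symm fun w' _ hn =>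
      by_contra fun h => hn (hmem w' h))
  have hncl : ¬ IsForcingClosed (G.induce {x : V | x ≠ v}) (Subtype.val ⁻¹' C) := fun h =>
    hne (isZeroForcingSet_iff_forall_isForcingClosed.1 hS _ (Set.image_subset_iff.1 hSC) h)
  simp only [IsForcingClosed, not_forall] at hncl
  obtain ⟨b, hb, w, hbw, hu, hw⟩ := hncl
  have hu' : ∀ w', G.Adj b w' → w' ∉ C → w' ≠ v → w' = w := fun w' hw' hn hne =>
    congrArg Subtype.val (hu ⟨w', hne⟩ hw' hn)
  have hbv : G.Adj b v := by
    by_contra hbv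
    exact hw (hC b hb w hbw fun w' hw' hn => hu' w' hw' hn fun h => hbv (h ▸ hw'))
  refine ⟨w, w.2, isZeroForcingSet_iff_forall_isForcingClosed.2 fun D hSD hD => ?_⟩
  have hSD' := (Set.subset_insert _ _).trans hSD
  have hCD : C ⊆ D := Set.sInter_subset_of_mem ⟨hSD', hD⟩
  refine hS.eq_univ_of_mem_deleted hD (hD b (hCD hb) v hbv fun w' hw' hn => ?_) hSD'
  by_contra hne
  exact hn (hu' w' hw' (fun h => hn (hCD h)) hne ▸ hSD (Set.mem_insert _ _))

theorem IsFaultTolerant.exists_insert_insert_of_deleted {V : Type*} [Finite V]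
    {G : SimpleGraph V} {v u : V} (hvu : G.Adj v u) {B : Set ↥{x : V | x ≠ v}}
    (hB : IsFaultTolerant (G.induce {x : V | x ≠ v}) 1 B) :
    ∃ x, IsFaultTolerant G 1 (insert v (insert x (Subtype.val '' B))) := by
  have : Nonempty ↥{x : V | x ≠ v} := ⟨⟨u, hvu.ne'⟩⟩
  have hzf := hB.isZeroForcingSet
  obtain ⟨x, hxv, hx⟩ := hzf.exists_insert_of_deleted hvu
  refine ⟨x, isFaultTolerant_one_of_diff_singleton (Set.insert_nonempty _ _) fun y hy => ?_⟩
  by_cases hyv : y = v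
  · subst hyv
    refine hx.mono fun z hz => ⟨Or.inr hz, ?_⟩
    rintro rfl
    rcases hz with h | ⟨z, -, h⟩
    · exact hxv h.symm
    · exact z.2 h
  by_cases hyB : y ∈ Subtype.val '' B
  · obtain ⟨y, hyB, rfl⟩ := hyB
    refine (hB.diff_singleton hyB).insert_deleted.mono ?_
    rintro _ (rfl | ⟨z, ⟨hz, hzy⟩, rfl⟩)
    · exact ⟨Or.inl rfl, fun h => hyv h.symm⟩
    · exact ⟨Or.inr (Or.inr ⟨z, hz, rfl⟩), fun h => hzy (Subtype.ext h)⟩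
  · refine hzf.insert_deleted.mono ?_
    rintro z (rfl | hz)
    · exact ⟨Or.inl rfl, fun h => hyv h.symm⟩
    · exact ⟨Or.inr (Or.inr hz), fun h => hyB (h ▸ hz)⟩

theorem stmt12 {V : Type*} [Fintype V] [DecidableEq V] (G : SimpleGraph V) (v : V)
    (hcard : 2 ≤ Fintype.card V)
    (hex : ∃ B : Set V, IsFaultTolerant G 1 B)
    (hiso : ∀ w, ∃ x, (G.induce {x : V | x ≠ v}).Adj w x) :
    (∃ B : Set ↥{x : V | x ≠ v}, IsFaultTolerant (G.induce {x : V | x ≠ v}) 1 B) ∧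
      (ftZeroForcingNumber G 1 : ℤ) -
        ftZeroForcingNumber (G.induce {x : V | x ≠ v}) 1 ≤ 2 := by
  obtain ⟨B₀, hB₀⟩ := hex
  obtain ⟨u, hvu⟩ := hB₀.exists_adj v
  have : Nonempty ↥{x : V | x ≠ v} := ⟨⟨u, hvu.ne'⟩⟩
  have hdel : ∃ B, IsFaultTolerant (G.induce {x : V | x ≠ v}) 1 B :=
    ⟨_, isFaultTolerant_one_univ hiso⟩
  refine ⟨hdel, ?_⟩
  obtain ⟨B, hB, hBcard⟩ : ∃ B, IsFaultTolerant (G.induce {x : V | x ≠ v}) 1 B ∧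
      B.ncard = ftZeroForcingNumber (G.induce {x : V | x ≠ v}) 1 :=
    Nat.sInf_mem (s := {m | ∃ B, IsFaultTolerant (G.induce {x : V | x ≠ v}) 1 B ∧ B.ncard = m})
      (hdel.imp' Set.ncard fun B hB => ⟨B, hB, rfl⟩)
  obtain ⟨x, hx⟩ := hB.exists_insert_insert_of_deleted hvu
  have hle : ftZeroForcingNumber G 1 ≤ (insert v (insert x (Subtype.val '' B))).ncard :=
    Nat.sInf_le ⟨_, hx, rfl⟩
  have h₁ := Set.ncard_insert_le v (insert x (Subtype.val '' B))
  have h₂ := Set.ncard_insert_le x (Subtype.val '' B)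
  rw [Set.ncard_image_of_injective B Subtype.val_injective] at h₂
  omega
end

section
/- Let G be a finite simple graph that has a pair of twin vertices (either independent or adjacent twins). Then for every integer k ≥ 2, G has no k-fault tolerant zero forcing set; that is, Z_t^k(G) does not exist for k ≥ 2. -/
open SimpleGraph

/-- `u` and `v` are twins: either independent twins (non-adjacent with the same open
neighborhood) or adjacent twins (adjacent with the same closed neighborhood). -/
def IsTwinPair {V : Type*} (G : SimpleGraph V) (u v : V) : Prop :=
  u ≠ v ∧ ((¬ G.Adj u v ∧ G.neighborSet u = G.neighborSet v) ∨
    (G.Adj u v ∧ insert u (G.neighborSet u) = insert v (G.neighborSet v)))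

theorem IsTwinPair.adj_iff {V : Type*} {G : SimpleGraph V} {u v b : V}
    (h : IsTwinPair G u v) (hu : b ≠ u) (hv : b ≠ v) : G.Adj b u ↔ G.Adj b v := by
  obtain ⟨_, ⟨_, h⟩ | ⟨_, h⟩⟩ := h
  · simpa [G.adj_comm] using Set.ext_iff.mp h b
  · simpa [hu, hv, G.adj_comm] using Set.ext_iff.mp h b

theorem IsTwinPair.notMem_zfStep {V : Type*} {G : SimpleGraph V} {u v : V} {B : Set V}
    (h : IsTwinPair G u v) (hu : u ∉ B) (hv : v ∉ B) :
    u ∉ zfStep G B ∧ v ∉ zfStep G B := by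
  constructor
  · rintro (hB | ⟨b, hb, hadj, huniq⟩)
    · exact hu hB
    · have hbv := (h.adj_iff (ne_of_mem_of_not_mem hb hu) (ne_of_mem_of_not_mem hb hv)).mp hadj
      exact h.1 (huniq v hbv hv).symm
  · rintro (hB | ⟨b, hb, hadj, huniq⟩)
    · exact hv hB
    · have hbu := (h.adj_iff (ne_of_mem_of_not_mem hb hu) (ne_of_mem_of_not_mem hb hv)).mpr hadj
      exact h.1 (huniq u hbu hu)

/-- A zero forcing set contains at least one vertex of every pair of twins. -/
theorem IsTwinPair.not_isZeroForcingSet {V : Type*} {G : SimpleGraph V} {u v : V} {B : Set V}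
    (h : IsTwinPair G u v) (hu : u ∉ B) (hv : v ∉ B) : ¬ IsZeroForcingSet G B := by
  rintro ⟨n, hn⟩
  have white : ∀ m : ℕ, u ∉ (zfStep G)^[m] B ∧ v ∉ (zfStep G)^[m] B := by
    intro m
    induction m with
    | zero => exact ⟨hu, hv⟩
    | succ m ih =>
      rw [Function.iterate_succ_apply']
      exact h.notMem_zfStep ih.1 ih.2
  exact (white n).1 (hn ▸ Set.mem_univ u)

theorem stmt15 {V : Type*} [Fintype V] (G : SimpleGraph V) (u v : V)
    (htwin : IsTwinPair G u v) (k : ℕ) (hk : 2 ≤ k) :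
    ¬ ∃ B : Set V, IsFaultTolerant G k B := by
  rintro ⟨B, hB⟩
  have hcard : B.ncard - k ≤ (B \ {u, v}).ncard := by
    have h := Set.le_ncard_sdiff {u, v} B (Set.toFinite _)
    rw [Set.ncard_pair htwin.1] at h
    omega
  obtain ⟨F, hF, hFcard⟩ := Set.exists_subset_card_eq hcard
  exact htwin.not_isZeroForcingSet (fun hu => (hF hu).2 (by simp)) (fun hv => (hF hv).2 (by simp))
    (hB F (hF.trans Set.sdiff_subset) hFcard)
end
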